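/- arXiv:1002.0807 — 4 statements merged into one kernel-verified Lean document; each statement's English description precedes it below -/
import Mathlib

section
/- Let p be a prime with p ≥ 5 and let m be a nonzero integer. Then the ideal of ℤ_p generated by the set {a^m − 1 : a ∈ ℤ_p^×} equals the ideal p^{v_p(m)+1}ℤ_p if (p−1) divides m, and equals the whole ring ℤ_p if (p−1) does not divide m. -/
/-- **Lifting the exponent** in `ℤ_p`, for odd `p`. -/
theorem PadicInt.emultiplicity_pow_sub_one {p : ℕ} [Fact p.Prime] (hp : Odd p) {x : ℤ_[p]}
    (hx : (p : ℤ_[p]) ∣ x - 1) {n : ℕ} (hn : n ≠ 0) :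
    emultiplicity (p : ℤ_[p]) (x ^ n - 1) =
      emultiplicity (p : ℤ_[p]) (x - 1) + padicValNat p n := by
  have hprime : Prime (p : ℤ_[p]) := PadicInt.prime_p
  have hx' : ¬ (p : ℤ_[p]) ∣ x := fun h =>
    hprime.not_isUnit (isUnit_of_dvd_one (by simpa using dvd_sub h hx))
  obtain ⟨k, c, hc, rfl⟩ := Nat.exists_eq_pow_mul_and_not_dvd hn p (Fact.out : p.Prime).ne_one
  have hc0 : c ≠ 0 := by
    rintro rfl
    simp at hc
  have hval : padicValNat p (p ^ k * c) = k := by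
    rw [padicValNat.mul (pow_ne_zero _ (Fact.out : p.Prime).ne_zero) hc0, padicValNat.prime_pow,
      padicValNat.eq_zero_of_not_dvd hc, add_zero]
  have hcast : ¬ (p : ℤ_[p]) ∣ (c : ℤ_[p]) := by
    have := PadicInt.pow_p_dvd_int_iff (p := p) 1 c
    rw [pow_one, pow_one, Int.natCast_dvd_natCast, Int.cast_natCast] at this
    rwa [this]
  have hpow : (p : ℤ_[p]) ∣ x ^ p ^ k - 1 := hx.trans (sub_one_dvd_pow_sub_one x _)
  have h₁ := emultiplicity_pow_sub_pow_of_prime hprime (y := 1) hpow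
    (fun h => hx' (hprime.dvd_of_dvd_pow h)) hcast
  have h₂ := emultiplicity_pow_prime_pow_sub_pow_prime_pow hprime hp hx hx' k
  rw [one_pow] at h₁ h₂
  rw [hval, pow_mul, h₁, h₂]

/-- If `p - 1 ∣ n`, then `p ^ (v_p(n) + 1)` divides `a ^ n - 1` for every unit `a` of `ℤ_p`. -/
theorem PadicInt.pow_padicValNat_add_one_dvd_units_pow_sub_one {p : ℕ} [Fact p.Prime] (hp : Odd p)
    {n : ℕ} (hn : n ≠ 0) (hdvd : p - 1 ∣ n) (a : ℤ_[p]ˣ) :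
    (p : ℤ_[p]) ^ (padicValNat p n + 1) ∣ (a : ℤ_[p]) ^ n - 1 := by
  obtain ⟨q, rfl⟩ := hdvd
  have hp2 : 2 ≤ p := (Fact.out : p.Prime).two_le
  have hq : q ≠ 0 := right_ne_zero_of_mul hn
  have hval : padicValNat p ((p - 1) * q) = padicValNat p q := by
    rw [padicValNat.mul (by omega) hq,
      padicValNat.eq_zero_of_not_dvd (Nat.not_dvd_of_pos_of_lt (by omega) (by omega)), zero_add]
  have hx : (p : ℤ_[p]) ∣ (a : ℤ_[p]) ^ (p - 1) - 1 := by
    rw [← Ideal.mem_span_singleton, ← PadicInt.maximalIdeal_eq_span_p, ← PadicInt.ker_toZMod,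
      RingHom.mem_ker, map_sub, map_pow, map_one,
      ZMod.pow_card_sub_one_eq_one (a.isUnit.map PadicInt.toZMod).ne_zero, sub_self]
  rw [hval, pow_mul]
  apply pow_dvd_of_le_emultiplicity
  rw [PadicInt.emultiplicity_pow_sub_one hp hx hq, Nat.cast_add, add_comm, Nat.cast_one]
  gcongr
  simpa using le_emultiplicity_of_pow_dvd (k := 1) (by simpa using hx)

/-- The element `(1 + p) ^ n - 1` of `ℤ_p` generates the same ideal as `p ^ (v_p(n) + 1)`. -/
theorem PadicInt.associated_one_add_p_pow_sub_one {p : ℕ} [Fact p.Prime] (hp : Odd p)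
    {n : ℕ} (hn : n ≠ 0) :
    Associated ((p : ℤ_[p]) ^ (padicValNat p n + 1)) ((1 + (p : ℤ_[p])) ^ n - 1) := by
  have hprime : Prime (p : ℤ_[p]) := PadicInt.prime_p
  have h := PadicInt.emultiplicity_pow_sub_one hp (x := 1 + (p : ℤ_[p])) (by simp) hn
  rw [add_sub_cancel_left, (FiniteMultiplicity.of_not_isUnit hprime.not_isUnit
    hprime.ne_zero).emultiplicity_self, add_comm 1 (_ : ℕ∞), ← ENat.natCast_one, ← ENat.natCast_add,
    emultiplicity_eq_coe] at h
  obtain ⟨⟨u, hu⟩, hnot⟩ := h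
  rw [hu, pow_succ, mul_dvd_mul_iff_left (pow_ne_zero _ hprime.ne_zero)] at hnot
  have hunit : IsUnit u := by
    by_contra h
    exact hnot ((PadicInt.norm_lt_one_iff_dvd u).1 (PadicInt.not_isUnit_iff.1 h))
  rw [hu]
  exact associated_mul_unit_right _ _ hunit

/-- If `p - 1 ∤ n`, then `a ^ n - 1` is a unit for some unit `a` of `ℤ_p`. -/
theorem PadicInt.exists_isUnit_units_pow_sub_one {p : ℕ} [Fact p.Prime] {n : ℕ}
    (hdvd : ¬ p - 1 ∣ n) : ∃ a : ℤ_[p]ˣ, IsUnit ((a : ℤ_[p]) ^ n - 1) := by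
  have h := FiniteField.forall_pow_eq_one_iff (ZMod p) n
  rw [ZMod.card] at h
  rw [← h] at hdvd
  push Not at hdvd
  obtain ⟨g, hg⟩ := hdvd
  have : IsLocalHom (PadicInt.toZMod (p := p)) :=
    (ZMod.ringHom_surjective PadicInt.toZMod).isLocalHom
  obtain ⟨a, rfl⟩ := IsLocalRing.surjective_units_map_of_local_ringHom PadicInt.toZMod
    (ZMod.ringHom_surjective PadicInt.toZMod) this g
  refine ⟨a, isUnit_of_map_unit PadicInt.toZMod _ (isUnit_iff_ne_zero.2 fun h0 => hg ?_)⟩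
  ext
  simpa [sub_eq_zero] using h0

/-- The `m`-th powers of the elements of a group are its `|m|`-th powers. -/
theorem exists_zpow_iff_exists_pow_natAbs {G : Type*} [Group G] (m : ℤ) (P : G → Prop) :
    (∃ a : G, P (a ^ m)) ↔ ∃ a : G, P (a ^ m.natAbs) := by
  obtain ⟨n, rfl | rfl⟩ := m.eq_nat_or_neg
  · simp
  · rw [(Equiv.inv G).surjective.exists]
    simp

/-- Let `p ≥ 5` be a prime and `m` a nonzero integer.  The ideal of `ℤ_p`
generated by `{a ^ m - 1 : a ∈ ℤ_pˣ}` equals `p ^ (v_p(m) + 1) ℤ_p` if `p - 1 ∣ m`,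
and equals the whole ring `ℤ_p` otherwise. -/
theorem stmt3 (p : ℕ) [Fact p.Prime] (hp : 5 ≤ p) (m : ℤ) (hm : m ≠ 0) :
    (((p : ℤ) - 1) ∣ m →
      Ideal.span {x : ℤ_[p] | ∃ a : ℤ_[p]ˣ, x = ((a ^ m : ℤ_[p]ˣ) : ℤ_[p]) - 1} =
        Ideal.span {(p : ℤ_[p]) ^ (padicValInt p m + 1)}) ∧
    (¬ ((p : ℤ) - 1) ∣ m →
      Ideal.span {x : ℤ_[p] | ∃ a : ℤ_[p]ˣ, x = ((a ^ m : ℤ_[p]ˣ) : ℤ_[p]) - 1} = ⊤) := by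
  have hodd : Odd p := (Fact.out : p.Prime).odd_of_ne_two (by omega)
  have hn : m.natAbs ≠ 0 := Int.natAbs_ne_zero.2 hm
  have hset : {x : ℤ_[p] | ∃ a : ℤ_[p]ˣ, x = ((a ^ m : ℤ_[p]ˣ) : ℤ_[p]) - 1} =
      {x : ℤ_[p] | ∃ a : ℤ_[p]ˣ, x = (a : ℤ_[p]) ^ m.natAbs - 1} := by
    ext x
    simpa using exists_zpow_iff_exists_pow_natAbs m fun u : ℤ_[p]ˣ => x = (u : ℤ_[p]) - 1
  have hdvd : ((p : ℤ) - 1) ∣ m ↔ p - 1 ∣ m.natAbs := by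
    rw [← Int.natCast_dvd, Nat.cast_sub (by omega), Nat.cast_one]
  rw [hset, hdvd]
  refine ⟨fun h => le_antisymm ?_ ?_, fun h => ?_⟩
  · rw [Ideal.span_le]
    rintro _ ⟨a, rfl⟩
    exact Ideal.mem_span_singleton.2
      (PadicInt.pow_padicValNat_add_one_dvd_units_pow_sub_one hodd hn h a)
  · have hunit : IsUnit (1 + (p : ℤ_[p])) := by
      by_contra h
      have h' := (PadicInt.norm_lt_one_iff_dvd _).1 (PadicInt.not_isUnit_iff.1 h)
      exact PadicInt.prime_p.not_isUnit (isUnit_of_dvd_one ((dvd_add_self_right).1 h'))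
    rw [padicValInt, Ideal.span_singleton_eq_span_singleton.2
      (PadicInt.associated_one_add_p_pow_sub_one hodd hn)]
    exact Ideal.span_mono (Set.singleton_subset_iff.2 ⟨hunit.unit, rfl⟩)
  · obtain ⟨a, ha⟩ := PadicInt.exists_isUnit_units_pow_sub_one h
    exact Ideal.eq_top_of_isUnit_mem _ (Ideal.subset_span ⟨a, rfl⟩) ha
end

section
/- Let p be a prime with p ≥ 5, let m be a nonzero integer, and set k = v_p(m)+1 if (p−1) divides m and k = 0 otherwise. Then for every module N over ℤ_p, the set of invariants {x ∈ N : a^m • x = x for all a ∈ ℤ_p^×} equals the p^k-torsion submodule {x ∈ N : p^k • x = 0}. (This identifies the 0-th cohomology of the central subgroup ℤ_p^× ⊂ 𝔾_2 acting on the degree-2m part of any chromatic module, as in Lemma 4.2 of the paper.) -/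
theorem PadicInt.toZModPow_eq_zero_iff_dvd {p : ℕ} [Fact p.Prime] (r : ℕ) (x : ℤ_[p]) :
    PadicInt.toZModPow r x = 0 ↔ (p : ℤ_[p]) ^ r ∣ x := by
  rw [← RingHom.mem_ker, PadicInt.ker_toZModPow, Ideal.mem_span_singleton]

theorem PadicInt.pow_dvd_unit_pow_sub_one {p : ℕ} [Fact p.Prime] {r n : ℕ}
    (h : (p ^ r).totient ∣ n) (a : ℤ_[p]ˣ) :
    (p : ℤ_[p]) ^ r ∣ (a : ℤ_[p]) ^ n - 1 := by
  obtain ⟨c, rfl⟩ := h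
  have key := ZMod.pow_totient
    (Units.map (PadicInt.toZModPow (p := p) r : ℤ_[p] →* ZMod (p ^ r)) a)
  have key' := congrArg Units.val key
  simp only [Units.val_pow_eq_pow_val, Units.coe_map, MonoidHom.coe_coe, Units.val_one] at key'
  rw [← PadicInt.toZModPow_eq_zero_iff_dvd, map_sub, map_pow, pow_mul, key']
  simp

theorem PadicInt.exists_unit_not_pow_dvd_pow_sub_one {p : ℕ} [Fact p.Prime] (hp : p ≠ 2)
    {r n : ℕ} (hr : r ≠ 0) (h : ¬ (p ^ r).totient ∣ n) :
    ∃ a : ℤ_[p]ˣ, ¬ (p : ℤ_[p]) ^ r ∣ (a : ℤ_[p]) ^ n - 1 := by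
  have hp' : p.Prime := Fact.out
  have : NeZero (p ^ r) := ⟨pow_ne_zero _ hp'.ne_zero⟩
  have := ZMod.isCyclic_units_of_prime_pow p hp' hp r
  obtain ⟨g, hg⟩ := IsCyclic.exists_generator (α := (ZMod (p ^ r))ˣ)
  have hord : orderOf g = (p ^ r).totient := by
    rw [orderOf_eq_card_of_forall_mem_zpowers hg, Nat.card_eq_fintype_card,
      ZMod.card_units_eq_totient]
  have hcop : (g : ZMod (p ^ r)).val.Coprime p :=
    (ZMod.val_coe_unit_coprime g).of_dvd_right (dvd_pow_self p hr)
  have hunit : IsUnit (((g : ZMod (p ^ r)).val : ℕ) : ℤ_[p]) := by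
    rw [PadicInt.isUnit_iff, ← Int.cast_natCast, PadicInt.norm_intCast_eq_one_iff]
    exact Nat.isCoprime_iff_coprime.mpr hcop
  obtain ⟨a, ha⟩ := hunit
  refine ⟨a, fun hdvd => h ?_⟩
  rw [← PadicInt.toZModPow_eq_zero_iff_dvd, ha, map_sub, map_pow, map_natCast,
    ZMod.natCast_zmod_val, map_one, sub_eq_zero] at hdvd
  rw [← hord]
  exact orderOf_dvd_of_pow_eq_one (Units.ext (by simpa using hdvd))

theorem PadicInt.dvd_pow_of_not_pow_succ_dvd {p : ℕ} [Fact p.Prime] {k : ℕ} {x : ℤ_[p]}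
    (h : ¬ (p : ℤ_[p]) ^ (k + 1) ∣ x) : x ∣ (p : ℤ_[p]) ^ k := by
  have hx : x ≠ 0 := by
    rintro rfl
    exact h (dvd_zero _)
  have hspec := PadicInt.unitCoeff_spec hx
  have hle : x.valuation ≤ k := by
    by_contra! hlt
    exact h ((pow_dvd_pow _ hlt).trans (Dvd.intro_left _ hspec.symm))
  rw [hspec, Units.mul_left_dvd]
  exact pow_dvd_pow _ hle

/-- For a nonzero `n`, the exponent `k` is the largest `r` such that the totient of `p ^ r`
divides `n`. -/
theorem totient_prime_pow_dvd_of_exponent {p n k : ℕ} [Fact p.Prime] (hn : n ≠ 0)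
    (hk : k = if p - 1 ∣ n then padicValNat p n + 1 else 0) :
    (p ^ k).totient ∣ n ∧ ¬ (p ^ (k + 1)).totient ∣ n := by
  have hp : p.Prime := Fact.out
  rw [Nat.totient_prime_pow_succ hp]
  split_ifs at hk with h
  · subst hk
    refine ⟨?_, fun hdvd => pow_succ_padicValNat_not_dvd hn ((Dvd.intro _ rfl).trans hdvd)⟩
    rw [Nat.totient_prime_pow_succ hp]
    have hcop : p.Coprime (p - 1) :=
      (Nat.coprime_self_sub_right hp.one_le).mpr (Nat.coprime_one_right p)
    exact (hcop.pow_left _).mul_dvd_of_dvd_of_dvd pow_padicValNat_dvd h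
  · subst hk
    simpa using h

theorem Units.zpow_smul_eq_iff_pow_natAbs_smul_eq {R N : Type*} [Ring R] [AddCommGroup N]
    [Module R N] (a : Rˣ) (m : ℤ) (x : N) :
    ((a ^ m : Rˣ) : R) • x = x ↔ ((a : R) ^ m.natAbs) • x = x := by
  rw [← Units.val_pow_eq_pow_val, ← Units.smul_def, ← Units.smul_def]
  rcases Int.natAbs_eq m with h | h
  · rw [h, zpow_natCast, Int.natAbs_natCast]
  · rw [h, zpow_neg, zpow_natCast, Int.natAbs_neg, Int.natAbs_natCast, inv_smul_eq_iff, eq_comm]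

/-- Let `p ≥ 5` be a prime, `m` a nonzero integer, and set
`k = v_p(m) + 1` if `p - 1 ∣ m` and `k = 0` otherwise.  Then for every `ℤ_p`-module `N`,
the invariants `{x ∈ N : a ^ m • x = x for all a ∈ ℤ_pˣ}` coincide with the
`p ^ k`-torsion submodule `{x ∈ N : p ^ k • x = 0}`. -/
theorem stmt4 (p : ℕ) [Fact p.Prime] (hp : 5 ≤ p) (m : ℤ) (hm : m ≠ 0)
    (k : ℕ) (hk : k = if ((p : ℤ) - 1) ∣ m then padicValInt p m + 1 else 0)
    (N : Type*) [AddCommGroup N] [Module ℤ_[p] N] :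
    {x : N | ∀ a : ℤ_[p]ˣ, ((a ^ m : ℤ_[p]ˣ) : ℤ_[p]) • x = x} =
      {x : N | ((p : ℤ_[p]) ^ k) • x = 0} := by
  have hdvd : ((p : ℤ) - 1) ∣ m ↔ p - 1 ∣ m.natAbs := by
    rw [← Int.natCast_dvd, Nat.cast_sub (by lia), Nat.cast_one]
  simp only [hdvd] at hk
  obtain ⟨h₁, h₂⟩ := totient_prime_pow_dvd_of_exponent (Int.natAbs_ne_zero.mpr hm) hk
  ext x
  simp only [Set.mem_ofPred_eq, Units.zpow_smul_eq_iff_pow_natAbs_smul_eq]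
  constructor
  · intro hx
    obtain ⟨a, ha⟩ :=
      PadicInt.exists_unit_not_pow_dvd_pow_sub_one (p := p) (by lia) k.succ_ne_zero h₂
    obtain ⟨c, hc⟩ := PadicInt.dvd_pow_of_not_pow_succ_dvd ha
    rw [hc, mul_comm, mul_smul, sub_smul, hx a, one_smul, sub_self, smul_zero]
  · intro hx a
    obtain ⟨c, hc⟩ := PadicInt.pow_dvd_unit_pow_sub_one h₁ a
    rw [← sub_eq_zero]
    calc (a : ℤ_[p]) ^ m.natAbs • x - x = ((a : ℤ_[p]) ^ m.natAbs - 1) • x := by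
          rw [sub_smul, one_smul]
      _ = 0 := by rw [hc, mul_comm, mul_smul, hx, smul_zero]
end

section
/- Let p be a prime with p ≥ 5, let m be a nonzero integer, and set k = v_p(m)+1 if (p−1) divides m and k = 0 otherwise. Then the subgroup {x ∈ ℚ_p/ℤ_p : a^m • x = x for all a ∈ ℤ_p^×} of ℚ_p/ℤ_p is cyclic of order p^k (in particular it is trivial when (p−1) does not divide m). This is the graded piece computation in Lemma 4.2 of the paper: H^{0,t}(ℤ_p^×; M_0^2(E_2)) carries a factor ℤ/p^k when t = p^{k−1}t'q with p ∤ t'. -/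
/-- The subgroup `ℤ_p ⊆ ℚ_p`, as a `ℤ_p`-submodule of `ℚ_p`, so that
`ℚ_[p] ⧸ padicSub p` is the `ℤ_p`-module `ℚ_p/ℤ_p`. -/
noncomputable def padicSub (p : ℕ) [Fact p.Prime] : Submodule ℤ_[p] ℚ_[p] :=
  LinearMap.range (Algebra.linearMap ℤ_[p] ℚ_[p])

theorem padicInt_pow_dvd_unit_zpow_sub_one_iff (p : ℕ) [Fact p.Prime] (n : ℕ) (m : ℤ)
    (a : ℤ_[p]ˣ) : (p : ℤ_[p]) ^ n ∣ ((a ^ m : ℤ_[p]ˣ) : ℤ_[p]) - 1 ↔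
      (Units.map (PadicInt.toZModPow n : ℤ_[p] →+* ZMod (p ^ n)).toMonoidHom a) ^ m = 1 := by
  rw [← Ideal.mem_span_singleton, ← PadicInt.ker_toZModPow, RingHom.mem_ker, map_sub, map_one,
    sub_eq_zero, ← map_zpow, Units.ext_iff]
  rfl

theorem padicInt_pow_dvd_unit_zpow_sub_one (p : ℕ) [Fact p.Prime] (n : ℕ) (m : ℤ)
    (h : (Nat.totient (p ^ n) : ℤ) ∣ m) (a : ℤ_[p]ˣ) :
    (p : ℤ_[p]) ^ n ∣ ((a ^ m : ℤ_[p]ˣ) : ℤ_[p]) - 1 := by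
  rw [padicInt_pow_dvd_unit_zpow_sub_one_iff]
  obtain ⟨c, rfl⟩ := h
  rw [zpow_mul, zpow_natCast, ZMod.pow_totient, one_zpow]

theorem padicInt_exists_unit_not_pow_dvd_zpow_sub_one (p : ℕ) [hp : Fact p.Prime] (hp2 : p ≠ 2)
    (n : ℕ) (m : ℤ) (h : ¬ (Nat.totient (p ^ (n + 1)) : ℤ) ∣ m) :
    ∃ a : ℤ_[p]ˣ, ¬ (p : ℤ_[p]) ^ (n + 1) ∣ ((a ^ m : ℤ_[p]ˣ) : ℤ_[p]) - 1 := by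
  have : Fact (1 < p ^ (n + 1)) := ⟨Nat.one_lt_pow (Nat.succ_ne_zero n) hp.out.one_lt⟩
  have := ZMod.isCyclic_units_of_prime_pow p hp.out hp2 (n + 1)
  obtain ⟨g, hg⟩ := IsCyclic.exists_generator (α := (ZMod (p ^ (n + 1)))ˣ)
  have hsurj : Function.Surjective (PadicInt.toZModPow (p := p) (n + 1)) :=
    ZMod.ringHom_surjective _
  have := IsLocalRing.of_surjective' _ hsurj
  have := IsLocalHom.of_surjective _ hsurj
  obtain ⟨a, ha⟩ := IsLocalRing.surjective_units_map_of_local_ringHom _ hsurj inferInstance g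
  refine ⟨a, fun hd => h ?_⟩
  rw [padicInt_pow_dvd_unit_zpow_sub_one_iff] at hd
  have hgm : g ^ m = 1 := ha ▸ hd
  rwa [← orderOf_dvd_iff_zpow_eq_one, orderOf_eq_card_of_forall_mem_zpowers hg,
    Nat.card_eq_fintype_card, ZMod.card_units_eq_totient] at hgm

theorem padicSub_mk_eq_zero_iff (p : ℕ) [Fact p.Prime] (y : ℚ_[p]) :
    (Submodule.Quotient.mk y : ℚ_[p] ⧸ padicSub p) = 0 ↔ ∃ z : ℤ_[p], (z : ℚ_[p]) = y := by
  rw [Submodule.Quotient.mk_eq_zero]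
  rfl

theorem padicSub_smul_mk_pow_inv_eq_zero_iff (p : ℕ) [hp : Fact p.Prime] (k : ℕ) (c : ℤ_[p]) :
    c • (Submodule.Quotient.mk (((p : ℚ_[p]) ^ k)⁻¹) : ℚ_[p] ⧸ padicSub p) = 0 ↔
      (p : ℤ_[p]) ^ k ∣ c := by
  have hp0 : (p : ℚ_[p]) ^ k ≠ 0 := pow_ne_zero _ (Nat.cast_ne_zero.mpr hp.out.ne_zero)
  rw [← Submodule.Quotient.mk_smul, padicSub_mk_eq_zero_iff]
  refine exists_congr fun z => ?_
  rw [Algebra.smul_def, PadicInt.algebraMap_apply, eq_mul_inv_iff_mul_eq₀ hp0, mul_comm, eq_comm]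
  norm_cast
  exact ⟨PadicInt.ext, congrArg _⟩

theorem exists_padicSub_mk_eq_smul (p : ℕ) [hp : Fact p.Prime] (k : ℕ) (c : ℤ_[p])
    (hc : ¬ (p : ℤ_[p]) ^ (k + 1) ∣ c) (x : ℚ_[p] ⧸ padicSub p) (hx : c • x = 0) :
    ∃ n : ℤ, n • (Submodule.Quotient.mk (((p : ℚ_[p]) ^ k)⁻¹) : ℚ_[p] ⧸ padicSub p) = x := by
  have hp0 : (p : ℚ_[p]) ^ k ≠ 0 := pow_ne_zero _ (Nat.cast_ne_zero.mpr hp.out.ne_zero)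
  have hc0 : c ≠ 0 := by rintro rfl; exact hc (dvd_zero _)
  have hv : c.valuation ≤ k := by
    by_contra! hlt
    refine hc ?_
    rw [PadicInt.unitCoeff_spec hc0]
    exact (pow_dvd_pow _ hlt).mul_left _
  have hdvd : c ∣ (p : ℤ_[p]) ^ k := by
    rw [PadicInt.unitCoeff_spec hc0]
    simpa using pow_dvd_pow (p : ℤ_[p]) hv
  have hpx : ((p : ℤ_[p]) ^ k) • x = 0 := by
    obtain ⟨d, hd⟩ := hdvd
    rw [hd, mul_comm, mul_smul, hx, smul_zero]
  obtain ⟨y, rfl⟩ := Submodule.Quotient.mk_surjective _ x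
  rw [← Submodule.Quotient.mk_smul, padicSub_mk_eq_zero_iff] at hpx
  obtain ⟨z, hz⟩ := hpx
  have hy : y = z • ((p : ℚ_[p]) ^ k)⁻¹ := by
    rw [Algebra.smul_def, PadicInt.algebraMap_apply, eq_mul_inv_iff_mul_eq₀ hp0, hz,
      Algebra.smul_def, PadicInt.algebraMap_apply, mul_comm]
    push_cast
    rfl
  refine ⟨z.appr k, ?_⟩
  rw [hy, Submodule.Quotient.mk_smul, ← Int.cast_smul_eq_zsmul ℤ_[p], eq_comm, ← sub_eq_zero,
    ← sub_smul, padicSub_smul_mk_pow_inv_eq_zero_iff, ← Ideal.mem_span_singleton]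
  exact_mod_cast PadicInt.appr_spec k z

/-- Let `p ≥ 5` be a prime, `m` a nonzero integer, and set
`k = v_p(m) + 1` if `p - 1 ∣ m` and `k = 0` otherwise.  Then the subgroup
`{x ∈ ℚ_p/ℤ_p : a ^ m • x = x for all a ∈ ℤ_pˣ}` of `ℚ_p/ℤ_p` is cyclic of
order `p ^ k`. -/
theorem stmt5 (p : ℕ) [Fact p.Prime] (hp : 5 ≤ p) (m : ℤ) (hm : m ≠ 0)
    (k : ℕ) (hk : k = if ((p : ℤ) - 1) ∣ m then padicValInt p m + 1 else 0) :
    ∃ g : ℚ_[p] ⧸ padicSub p,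
      (∀ a : ℤ_[p]ˣ, ((a ^ m : ℤ_[p]ˣ) : ℤ_[p]) • g = g) ∧
      addOrderOf g = p ^ k ∧
      {x : ℚ_[p] ⧸ padicSub p | ∀ a : ℤ_[p]ˣ, ((a ^ m : ℤ_[p]ˣ) : ℤ_[p]) • x = x} =
        Set.range (fun n : ℤ => n • g) := by
  have hpp : p.Prime := Fact.out
  have hcast : ((p - 1 : ℕ) : ℤ) = (p : ℤ) - 1 := by push_cast [hpp.one_le]; rfl
  have hfix (a : ℤ_[p]ˣ) : (p : ℤ_[p]) ^ k ∣ ((a ^ m : ℤ_[p]ˣ) : ℤ_[p]) - 1 := by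
    apply padicInt_pow_dvd_unit_zpow_sub_one
    split_ifs at hk with h
    · subst hk
      rw [Nat.totient_prime_pow_succ hpp, Nat.cast_mul, hcast]
      refine IsCoprime.mul_dvd ?_ ?_ h
      · rw [← hcast, Nat.isCoprime_iff_coprime]
        exact Nat.Coprime.pow_left _ ((Nat.coprime_self_sub_right hpp.one_le).mpr (by simp))
      · exact_mod_cast padicValInt_dvd m
    · simp [hk]
  have hnot : ¬ (Nat.totient (p ^ (k + 1)) : ℤ) ∣ m := by
    rw [Nat.totient_prime_pow_succ hpp, Nat.cast_mul, hcast]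
    intro h
    rw [if_pos (dvd_of_mul_left_dvd h)] at hk
    have hd : (p : ℤ) ^ k ∣ m := by exact_mod_cast dvd_of_mul_right_dvd h
    rw [padicValInt_dvd_iff] at hd
    have := hd.resolve_left hm
    omega
  obtain ⟨a, ha⟩ := padicInt_exists_unit_not_pow_dvd_zpow_sub_one p (by omega) k m hnot
  have hg (b : ℤ_[p]ˣ) : ((b ^ m : ℤ_[p]ˣ) : ℤ_[p]) •
      (Submodule.Quotient.mk (((p : ℚ_[p]) ^ k)⁻¹) : ℚ_[p] ⧸ padicSub p) =
        Submodule.Quotient.mk (((p : ℚ_[p]) ^ k)⁻¹) := by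
    have := (padicSub_smul_mk_pow_inv_eq_zero_iff p k _).mpr (hfix b)
    rwa [sub_smul, one_smul, sub_eq_zero] at this
  refine ⟨Submodule.Quotient.mk (((p : ℚ_[p]) ^ k)⁻¹), hg, ?_, ?_⟩
  · refine Nat.dvd_right_iff_eq.mp fun n => ?_
    rw [addOrderOf_dvd_iff_nsmul_eq_zero, ← Nat.cast_smul_eq_nsmul ℤ_[p],
      padicSub_smul_mk_pow_inv_eq_zero_iff]
    have := PadicInt.pow_p_dvd_int_iff (p := p) k n
    exact_mod_cast this
  · ext x
    constructor
    · intro hx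
      apply exists_padicSub_mk_eq_smul p k _ ha x
      rw [sub_smul, one_smul, hx a, sub_self]
    · rintro ⟨n, rfl⟩ b
      rw [smul_comm, hg b]
end

section
/- Let p be a prime with p ≥ 5, let W = W(𝔽_{p²}) be the ring of p-typical Witt vectors of the field 𝔽_{p²}, and let σ denote the automorphism of the unit group W^× induced by the ring automorphism of W coming functorially from the Frobenius x ↦ x^p of 𝔽_{p²}. Let E be the set of group endomorphisms f : W^× → W^× satisfying f ∘ σ = σ ∘ f. Then E, with group operation given by pointwise multiplication ((f·g)(u) = f(u)g(u)), is an abelian group isomorphic to ℤ_p × ℤ_p × ℤ/(p²−1). (This is the identification End^c(𝕎^×)^{Gal} ≅ ℤ_p × ℤ_p × ℤ/(p²−1), the crux labelled (†) in the proof of Theorem 7.1 of the paper.) -/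
/-- The Galois action `σ` on `W(𝔽_{p²})`: the ring automorphism induced functorially
by the Frobenius `x ↦ x ^ p` of `𝔽_{p²}`. -/
noncomputable def frobW (p : ℕ) [Fact p.Prime] :
    WittVector p (GaloisField p 2) →+* WittVector p (GaloisField p 2) :=
  WittVector.map (frobenius (GaloisField p 2) p)

theorem exists_limit_of_dvd_sub {R : Type*} [CommRing R] {q : R}
    [IsAdicComplete (Ideal.span {q}) R] (f : ℕ → R) (hf : ∀ n, q ^ n ∣ f (n + 1) - f n) :
    ∃ L, ∀ n, q ^ n ∣ L - f n := by
  have hle : ∀ {m n}, m ≤ n → q ^ m ∣ f n - f m := by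
    intro m n h
    induction n, h using Nat.le_induction with
    | base => simp
    | succ n hmn ih =>
      rw [← sub_add_sub_cancel _ (f n)]
      exact dvd_add ((pow_dvd_pow q hmn).trans (hf n)) ih
  obtain ⟨L, hL⟩ := IsPrecomplete.prec' (I := Ideal.span {q}) f (by
    intro m n h
    rw [SModEq.comm, SModEq.sub_mem, smul_eq_mul, Ideal.mul_top, Ideal.span_singleton_pow,
      Ideal.mem_span_singleton]
    exact hle h)
  refine ⟨L, fun n => ?_⟩
  have := hL n
  rwa [SModEq.comm, SModEq.sub_mem, smul_eq_mul, Ideal.mul_top, Ideal.span_singleton_pow,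
      Ideal.mem_span_singleton] at this

theorem eq_zero_of_forall_pow_dvd {R : Type*} [CommRing R] (q : R)
    [IsAdicComplete (Ideal.span {q}) R] {x : R} (hx : ∀ n, q ^ n ∣ x) : x = 0 := by
  refine IsHausdorff.haus' (I := Ideal.span {q}) x fun n => ?_
  rw [SModEq.zero, smul_eq_mul, Ideal.mul_top, Ideal.span_singleton_pow,
      Ideal.mem_span_singleton]
  exact hx n

theorem exists_one_add_pow_eq {R : Type*} [CommRing R] (t : R) (n : ℕ) :
    ∃ h, (1 + t) ^ n = 1 + n * t + n.choose 2 * t ^ 2 + t ^ 3 * h := by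
  induction n with
  | zero => exact ⟨0, by simp⟩
  | succ n ih =>
    obtain ⟨h, hh⟩ := ih
    refine ⟨n.choose 2 + h * (1 + t), ?_⟩
    rw [pow_succ, hh, Nat.choose_succ_succ' n 1, Nat.choose_one_right]
    push_cast
    ring

theorem exists_one_add_prime_mul_pow_eq {R : Type*} [CommRing R] {p : ℕ} (hp : p.Prime)
    (h2 : 2 < p) (m : ℕ) (z : R) :
    ∃ h, (1 + (p : R) ^ (m + 1) * z) ^ p =
      1 + (p : R) ^ (m + 2) * (z + (p : R) ^ (m + 1) * (z ^ 2 * h)) := by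
  obtain ⟨h, hh⟩ := exists_one_add_pow_eq ((p : R) ^ (m + 1) * z) p
  obtain ⟨k, hk⟩ := hp.dvd_choose_self two_ne_zero h2
  refine ⟨k + (p : R) ^ m * z * h, ?_⟩
  rw [hh, hk]
  push_cast
  ring

/-- `y` is `p⁻¹ log (1 + p x)`, where `log u` is the limit of `(u ^ p ^ m - 1) / p ^ m`. -/
def IsScaledLog {R : Type*} [CommRing R] (p : ℕ) (x y : R) : Prop :=
  ∀ m, (p : R) ^ (2 * m + 2) ∣ (1 + p * x) ^ p ^ m - (1 + (p : R) ^ (m + 1) * y)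

namespace IsScaledLog

variable {R : Type*} [CommRing R] {p : ℕ}

theorem map {S : Type*} [CommRing S] (σ : R →+* S) {x y : R} (h : IsScaledLog p x y) :
    IsScaledLog p (σ x) (σ y) := fun m => by
  simpa using map_dvd σ (h m)

theorem add_mul {x y x' y' : R} (h : IsScaledLog p x y) (h' : IsScaledLog p x' y') :
    IsScaledLog p (x + x' + p * (x * x')) (y + y') := fun m => by
  obtain ⟨a, ha⟩ := h m
  obtain ⟨b, hb⟩ := h' m
  rw [sub_eq_iff_eq_add] at ha hb
  have : 1 + (p : R) * (x + x' + p * (x * x')) = (1 + p * x) * (1 + p * x') := by ring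
  rw [this, mul_pow, ha, hb]
  refine ⟨(p : R) ^ (2 * m + 2) * a * b + a * (1 + p ^ (m + 1) * y') +
    b * (1 + p ^ (m + 1) * y) + y * y', ?_⟩
  ring

theorem unique [IsDomain R] [IsAdicComplete (Ideal.span {(p : R)}) R] (hp : (p : R) ≠ 0)
    {x y y' : R} (h : IsScaledLog p x y) (h' : IsScaledLog p x y') : y = y' := by
  refine sub_eq_zero.1 (eq_zero_of_forall_pow_dvd (p : R) fun m => ?_)
  have := dvd_sub (h' m) (h m)
  have e : (p : R) ^ (m + 1) * p ^ (m + 1) ∣ p ^ (m + 1) * (y - y') := by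
    convert this using 1 <;> ring
  exact (pow_dvd_pow _ m.le_succ).trans ((mul_dvd_mul_iff_left (pow_ne_zero _ hp)).1 e)

theorem exists_of_prime [IsAdicComplete (Ideal.span {(p : R)}) R] (hp : p.Prime) (h2 : 2 < p)
    (x : R) : ∃ y, IsScaledLog p x y ∧ ∀ n, (p : R) ^ n ∣ x → (p : R) ^ (n + 1) ∣ y - x := by
  choose h hh using exists_one_add_prime_mul_pow_eq (R := R) hp h2
  let s : ℕ → R := Nat.rec x fun m z => z + (p : R) ^ (m + 1) * (z ^ 2 * h m z)
  have s0 : s 0 = x := rfl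
  have hs (m) : s (m + 1) = s m + (p : R) ^ (m + 1) * (s m ^ 2 * h m (s m)) := rfl
  have hpow (m) : (1 + p * x) ^ p ^ m = 1 + (p : R) ^ (m + 1) * s m := by
    induction m with
    | zero => simp [s0]
    | succ m ih => rw [pow_succ, pow_mul, ih, hh, hs]
  have hdvd (n) (hx : (p : R) ^ n ∣ x) (m) : (p : R) ^ (n + 1) ∣ s m - x := by
    induction m with
    | zero => simp [s0]
    | succ m ih =>
      have hsm : (p : R) ^ n ∣ s m := by
        simpa using dvd_add ((pow_dvd_pow _ n.le_succ).trans ih) hx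
      rw [hs, add_sub_right_comm]
      refine dvd_add ih ?_
      rw [pow_succ']
      exact mul_dvd_mul (dvd_pow_self _ m.succ_ne_zero)
        ((dvd_pow hsm two_ne_zero).mul_right _)
  obtain ⟨y, hy⟩ := exists_limit_of_dvd_sub (q := (p : R)) (fun m => s (m - 1)) (fun m => by
    cases m with
    | zero => simp
    | succ m => simp [hs])
  have hy' (m) : (p : R) ^ (m + 1) ∣ y - s m := hy (m + 1)
  refine ⟨y, fun m => ?_, fun n hn => ?_⟩
  · rw [hpow, ← dvd_neg]
    convert mul_dvd_mul_left ((p : R) ^ (m + 1)) (hy' m) using 1 <;> ring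
  · rw [← sub_add_sub_cancel _ (s n)]
    exact dvd_add (hy' n) (hdvd n hn n)

end IsScaledLog

theorem exists_scaledLog {R : Type*} [CommRing R] [IsDomain R] {p : ℕ}
    [IsAdicComplete (Ideal.span {(p : R)}) R] (hp : p.Prime) (h2 : 2 < p) (hp0 : (p : R) ≠ 0) :
    ∃ ℓ : R → R, (∀ x, IsScaledLog p x (ℓ x)) ∧
      (∀ x x', ℓ (x + x' + p * (x * x')) = ℓ x + ℓ x') ∧ Function.Bijective ℓ := by
  choose ℓ hℓ hdvd using IsScaledLog.exists_of_prime (R := R) hp h2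
  have hadd (x x') : ℓ (x + x' + p * (x * x')) = ℓ x + ℓ x' :=
    (hℓ _).unique hp0 ((hℓ x).add_mul (hℓ x'))
  have hunit (x : R) : IsUnit (1 + p * x) := by
    have hj : (p : R) ∈ (⊥ : Ideal R).jacobson :=
      IsAdicComplete.le_jacobson_bot (Ideal.span {(p : R)}) (Ideal.mem_span_singleton_self _)
    have := Ideal.mem_jacobson_bot.1 hj x
    rwa [add_comm]
  have hquot (u v n) (huv : (p : R) ^ n ∣ u - v) :
      ∃ w, (p : R) ^ n ∣ w ∧ u = v + w + p * (v * w) := by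
    obtain ⟨a, ha⟩ := huv
    obtain ⟨b, hb⟩ := (hunit v).exists_right_inv
    refine ⟨p ^ n * (a * b), dvd_mul_right _ _, ?_⟩
    linear_combination ha - p ^ n * a * hb
  have hker {x} (hx : ℓ x = 0) : x = 0 := by
    refine eq_zero_of_forall_pow_dvd (p : R) fun n => ?_
    induction n with
    | zero => simp
    | succ n ih => simpa [hx] using hdvd x n ih
  refine ⟨ℓ, hℓ, hadd, fun u v huv => ?_, fun y => ?_⟩
  · obtain ⟨w, -, hw⟩ := hquot u v 0 (by simp)
    have : ℓ w = 0 := by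
      rw [hw, hadd] at huv
      simpa using huv
    simpa [hker this] using hw
  · have step (n : ℕ) (u : {u : R // (p : R) ^ n ∣ y - ℓ u}) :
        ∃ v : {v : R // (p : R) ^ (n + 1) ∣ y - ℓ v}, (p : R) ^ n ∣ (v : R) - u := by
      obtain ⟨u, hu⟩ := u
      refine ⟨⟨u + (y - ℓ u) + p * (u * (y - ℓ u)), ?_⟩, ?_⟩
      · rw [hadd, ← dvd_neg]
        convert hdvd _ n hu using 1
        ring
      · exact (hu.mul_right (1 + p * u)).trans (dvd_of_eq (by ring))
    choose next hnext using step
    let s : ∀ n, {u : R // (p : R) ^ n ∣ y - ℓ u} := Nat.rec ⟨0, by simp⟩ next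
    have hs (n) : (p : R) ^ n ∣ (s (n + 1)).1 - (s n).1 := hnext n (s n)
    obtain ⟨u, hu⟩ := exists_limit_of_dvd_sub (q := (p : R)) (fun n => (s n).1) hs
    refine ⟨u, (sub_eq_zero.1 (eq_zero_of_forall_pow_dvd (p : R) fun n => ?_)).symm⟩
    obtain ⟨w, hw, huw⟩ := hquot _ _ _ (hu n)
    have hlw : (p : R) ^ n ∣ ℓ w := by
      simpa using dvd_add ((pow_dvd_pow _ n.le_succ).trans (hdvd w n hw)) hw
    rw [huw, hadd, ← sub_sub]
    exact dvd_sub (s n).2 hlw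

/-- `W(k)ˣ` is isomorphic to `kˣ × W(k)`, by the Teichmüller lift on the first factor and the
inverse of the scaled logarithm on the second, compatibly with endomorphisms of `k`. -/
theorem WittVector.exists_units_mulEquiv (p : ℕ) [Fact p.Prime] (hp : 2 < p) (k : Type*) [Field k]
    [CharP k p] [PerfectRing k p] :
    ∃ Θ : kˣ × Multiplicative (WittVector p k) ≃* (WittVector p k)ˣ,
      ∀ (φ : k →+* k) (z : kˣ × Multiplicative (WittVector p k)),
        Units.map (WittVector.map φ).toMonoidHom (Θ z) =
          Θ (Units.map φ.toMonoidHom z.1,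
            (WittVector.map φ).toAddMonoidHom.toMultiplicative z.2) := by
  have hp0 : (p : WittVector p k) ≠ 0 := WittVector.p_nonzero p k
  obtain ⟨ℓ, hlog, hadd, hbij⟩ := exists_scaledLog (R := WittVector p k) Fact.out hp hp0
  obtain ⟨e, hleft, hright⟩ := Function.bijective_iff_has_inverse.1 hbij
  have hℓ0 : ℓ 0 = 0 := by simpa using hadd 0 0
  have he0 : e 0 = 0 := hbij.1 (by rw [hright, hℓ0])
  have hemul (y y') : (1 + p * e y) * (1 + p * e y') = 1 + p * e (y + y') := by
    have : e (y + y') = e y + e y' + p * (e y * e y') := by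
      apply hbij.1
      rw [hright, hadd, hright, hright]
    rw [this]
    ring
  let E : Multiplicative (WittVector p k) →* (WittVector p k)ˣ := MonoidHom.toHomUnits
    { toFun := fun y => 1 + p * e y.toAdd
      map_one' := by simp [he0]
      map_mul' := fun y y' => (hemul _ _).symm }
  have hE (y) : (E y : WittVector p k) = 1 + p * e y.toAdd := rfl
  have hcp : WittVector.constantCoeff (p : WittVector p k) = 0 := by simp
  have hinj : Function.Injective
      ((Units.map (WittVector.teichmuller p (R := k))).coprod E) := by
    rw [injective_iff_map_eq_one]
    rintro ⟨a, y⟩ h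
    have h' := congrArg Units.val h
    simp only [MonoidHom.coprod_apply, Units.val_mul, Units.coe_map, hE, Units.val_one] at h'
    have ha : a = 1 := by
      have := congrArg WittVector.constantCoeff h'
      rw [map_mul, map_add, map_mul, hcp] at this
      ext
      simpa using this
    subst ha
    have hy : e y.toAdd = 0 := by simpa [hp0] using h'
    have : y.toAdd = 0 := by
      rw [← hright y.toAdd, hy, hℓ0]
    exact Prod.ext rfl (Multiplicative.toAdd.injective this)
  have hsurj : Function.Surjective
      ((Units.map (WittVector.teichmuller p (R := k))).coprod E) := by
    intro u
    let a : kˣ := Units.map (WittVector.constantCoeff (p := p) (R := k)).toMonoidHom u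
    let v := Units.map (WittVector.teichmuller p (R := k)) a
    have hv : (v : WittVector p k).coeff 0 = (u : WittVector p k).coeff 0 :=
      WittVector.teichmuller_coeff_zero _ _
    have hv' : WittVector.constantCoeff ((u - v : WittVector p k)) = 0 := by
      rw [map_sub]
      exact sub_eq_zero.2 hv.symm
    have : ((u - v : WittVector p k)) ∈ Ideal.span {(p : WittVector p k)} := by
      rw [← WittVector.ker_constantCoeff]
      exact hv'
    obtain ⟨x, hx⟩ := Ideal.mem_span_singleton.1 this
    refine ⟨(a, Multiplicative.ofAdd (ℓ (↑v⁻¹ * x))), ?_⟩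
    ext1
    simp only [MonoidHom.coprod_apply, Units.val_mul, hE, toAdd_ofAdd]
    rw [hleft]
    change (v : WittVector p k) * _ = _
    linear_combination p * x * v.mul_inv - hx
  refine ⟨MulEquiv.ofBijective _ ⟨hinj, hsurj⟩, ?_⟩
  rintro φ ⟨a, y⟩
  ext1
  have hφ : WittVector.map φ (e y.toAdd) = e (WittVector.map φ y.toAdd) := by
    apply hbij.1
    have := (hlog (e y.toAdd)).map (WittVector.map φ)
    rw [hright]
    rw [hright] at this
    exact (hlog _).unique hp0 this
  change WittVector.map φ (WittVector.teichmuller p (a : k) * (E y).1) =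
    WittVector.teichmuller p (φ a) *
      (E (Multiplicative.ofAdd (WittVector.map φ y.toAdd))).1
  simp [hE, hφ]

theorem MonoidHom.exists_eq_prodMap {A B : Type*} [CommMonoid A] [CommMonoid B]
    (hAB : ∀ f : A →* B, f = 1) (hBA : ∀ f : B →* A, f = 1) (f : A × B →* A × B) :
    ∃ (g : A →* A) (h : B →* B), f = g.prodMap h := by
  refine ⟨(fst A B).comp (f.comp (inl A B)), (snd A B).comp (f.comp (inr A B)), ?_⟩
  have h1 (a) : (f (a, 1)).2 = 1 := DFunLike.congr_fun (hAB ((snd A B).comp (f.comp (inl A B)))) a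
  have h2 (b) : (f (1, b)).1 = 1 := DFunLike.congr_fun (hBA ((fst A B).comp (f.comp (inr A B)))) b
  ext1 ⟨a, b⟩
  have : f (a, b) = f (a, 1) * f (1, b) := by simp [← map_mul]
  ext <;> simp [this, h1, h2]

theorem IsCyclic.exists_pow_zmodVal_eq {A : Type*} [CommGroup A] [IsCyclic A] {n : ℕ} [NeZero n]
    (hA : Nat.card A = n) (g : A →* A) : ∃ m : ZMod n, ∀ a, g a = a ^ m.val := by
  obtain ⟨m, hm⟩ := MonoidHom.map_cyclic g
  refine ⟨m, fun a => ?_⟩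
  rw [hm, ← zpow_natCast, ZMod.val_intCast, ← hA, zpow_mod_natCard]

theorem pow_zmodVal_add {A : Type*} [Group A] {n : ℕ} [NeZero n] (hA : Nat.card A = n)
    (a : A) (m m' : ZMod n) : a ^ (m + m').val = a ^ (m.val + m'.val) := by
  rw [ZMod.val_add]
  subst hA
  exact pow_mod_natCard a _

theorem IsCyclic.pow_zmodVal_injective {A : Type*} [CommGroup A] [IsCyclic A] {n : ℕ} [NeZero n]
    (hA : Nat.card A = n) {m m' : ZMod n} (h : ∀ a : A, a ^ m.val = a ^ m'.val) : m = m' := by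
  obtain ⟨a, ha⟩ := IsCyclic.exists_ofOrder_eq_natCard (α := A)
  have := pow_inj_mod.1 (h a)
  rw [ha, hA, Nat.mod_eq_of_lt (ZMod.val_lt _), Nat.mod_eq_of_lt (ZMod.val_lt _)] at this
  exact ZMod.val_injective n this

section Equivariant

variable (p : ℕ) [Fact p.Prime]

local notation "𝕎" => WittVector p (GaloisField p 2)

theorem frobW_coeff (w : 𝕎) (n : ℕ) : (frobW p w).coeff n = w.coeff n ^ p := rfl

theorem frobW_frobW (w : 𝕎) : frobW p (frobW p w) = w := by
  ext n
  have := Fintype.ofFinite (GaloisField p 2)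
  have hc : Fintype.card (GaloisField p 2) = p ^ 2 := by
    rw [← Nat.card_eq_fintype_card, GaloisField.card p 2 two_ne_zero]
  rw [frobW_coeff, frobW_coeff, ← pow_mul, ← sq, ← hc, FiniteField.pow_card]

/-- The canonical embedding `ℤ_p = W(𝔽_p) → W(𝔽_{p²})`. -/
noncomputable def padicToW : ℤ_[p] →+* 𝕎 :=
  (WittVector.map (algebraMap (ZMod p) (GaloisField p 2))).comp (WittVector.fromPadicInt p)

theorem padicToW_injective : Function.Injective (padicToW p) :=
  (WittVector.map_injective _ (algebraMap (ZMod p) (GaloisField p 2)).injective).comp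
    (WittVector.equiv p).symm.injective

theorem frobW_padicToW (c : ℤ_[p]) : frobW p (padicToW p c) = padicToW p c := by
  ext n
  rw [frobW_coeff, padicToW, RingHom.comp_apply, WittVector.map_coeff, ← map_pow, ZMod.pow_card]

theorem exists_algebraMap_eq_of_pow_eq {K : Type*} [Field K] [Algebra (ZMod p) K] {x : K}
    (hx : x ^ p = x) : ∃ z : ZMod p, algebraMap (ZMod p) K z = x := by
  have : CharP K p := charP_of_injective_algebraMap (algebraMap (ZMod p) K).injective p
  obtain ⟨m, hm⟩ := (_root_.mem_bot_iff_intCast p K).1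
    ((Subfield.mem_bot_iff_pow_eq_self K p).2 hx)
  exact ⟨m, by simpa using hm⟩

theorem exists_padicToW_eq {w : 𝕎} (hw : frobW p w = w) : ∃ c, padicToW p c = w := by
  have (n : ℕ) : ∃ z : ZMod p, algebraMap (ZMod p) (GaloisField p 2) z = w.coeff n :=
    exists_algebraMap_eq_of_pow_eq p (by rw [← frobW_coeff, hw])
  choose z hz using this
  refine ⟨WittVector.toPadicInt p (WittVector.mk p z), ?_⟩
  rw [padicToW, RingHom.comp_apply, ← RingHom.comp_apply (WittVector.fromPadicInt p),
    WittVector.fromPadicInt_comp_toPadicInt_ext]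
  ext n
  rw [WittVector.map_coeff, ← hz]
  rfl

theorem exists_isUnit_frobW_eq_neg : ∃ ε : 𝕎, IsUnit ε ∧ frobW p ε = -ε := by
  obtain ⟨x, hx⟩ : ∃ x : GaloisField p 2, x ^ p ≠ x := by
    by_contra! h
    have hle : Nat.card (GaloisField p 2) ≤ Nat.card (ZMod p) :=
      Nat.card_le_card_of_surjective (algebraMap (ZMod p) (GaloisField p 2)) fun x =>
        exists_algebraMap_eq_of_pow_eq p (h x)
    rw [GaloisField.card p 2 two_ne_zero, Nat.card_zmod] at hle
    nlinarith [(Fact.out : p.Prime).one_lt]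
  let ξ := WittVector.teichmuller p x
  refine ⟨ξ - frobW p ξ, WittVector.isUnit_of_coeff_zero_ne_zero _ ?_, ?_⟩
  · have h : WittVector.constantCoeff (ξ - frobW p ξ) = x - x ^ p := by
      rw [map_sub]
      change ξ.coeff 0 - (frobW p ξ).coeff 0 = _
      rw [frobW_coeff, WittVector.teichmuller_coeff_zero]
    change WittVector.constantCoeff (ξ - frobW p ξ) ≠ 0
    rw [h]
    exact sub_ne_zero.2 hx.symm
  · rw [map_sub, frobW_frobW, neg_sub]

theorem two_ne_zero_W : (2 : 𝕎) ≠ 0 := by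
  intro h
  have : padicToW p 2 = padicToW p 0 := by rw [map_ofNat, map_zero, h]
  exact two_ne_zero (padicToW_injective p this)

theorem addMonoidHom_padicToW_mul_eq_zero (F : 𝕎 →+ 𝕎) {ε : 𝕎} (hε : F ε = 0) (c : ℤ_[p]) :
    F (padicToW p c * ε) = 0 := by
  refine eq_zero_of_forall_pow_dvd (p : 𝕎) fun n => ?_
  obtain ⟨d, hd⟩ := Ideal.mem_span_singleton.1 (c.appr_spec n)
  rw [sub_eq_iff_eq_add] at hd
  have : padicToW p c * ε = (p ^ n) • (padicToW p d * ε) + (c.appr n) • ε := by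
    nth_rw 1 [hd]
    simp only [map_add, map_mul, map_pow, map_natCast, nsmul_eq_mul, Nat.cast_pow]
    ring
  rw [this, map_add, map_nsmul, map_nsmul, hε, nsmul_eq_mul]
  simp

/-- The action of the element `c + d σ` of `ℤ_p[⟨σ⟩]` on `W(𝔽_{p²})`. -/
noncomputable def groupRingAction (c d : ℤ_[p]) : 𝕎 →+ 𝕎 :=
  AddMonoidHom.mulLeft (padicToW p c) +
    (AddMonoidHom.mulLeft (padicToW p d)).comp (frobW p).toAddMonoidHom

theorem groupRingAction_apply (c d : ℤ_[p]) (w : 𝕎) :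
    groupRingAction p c d w = padicToW p c * w + padicToW p d * frobW p w := rfl

theorem groupRingAction_frobW (c d : ℤ_[p]) (w : 𝕎) :
    groupRingAction p c d (frobW p w) = frobW p (groupRingAction p c d w) := by
  simp [groupRingAction_apply, frobW_padicToW]

theorem groupRingAction_injective {c d c' d' : ℤ_[p]}
    (h : groupRingAction p c d = groupRingAction p c' d') : c = c' ∧ d = d' := by
  obtain ⟨ε, hu, hε⟩ := exists_isUnit_frobW_eq_neg p
  have h1 := DFunLike.congr_fun h 1
  have h2 := DFunLike.congr_fun h ε
  simp only [groupRingAction_apply, hε, map_one, mul_one] at h1 h2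
  have h3 : padicToW p c - padicToW p d = padicToW p c' - padicToW p d' :=
    hu.mul_right_cancel (by linear_combination h2)
  have h4 := two_ne_zero_W p
  constructor <;> refine padicToW_injective p (mul_left_cancel₀ h4 ?_)
  · linear_combination h1 + h3
  · linear_combination h1 - h3

theorem exists_groupRingAction_eq (hp : p ≠ 2) (g : 𝕎 →+ 𝕎)
    (hg : ∀ w, g (frobW p w) = frobW p (g w)) : ∃ c d, g = groupRingAction p c d := by
  obtain ⟨ε, hu, hε⟩ := exists_isUnit_frobW_eq_neg p
  obtain ⟨η, hη⟩ := hu.exists_left_inv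
  have hfix_mul {w : 𝕎} (hw : frobW p w = -w) : frobW p (w * η) = w * η := by
    apply hu.mul_right_cancel
    have : frobW p η * -ε = 1 := by rw [← hε, ← map_mul, hη, map_one]
    rw [map_mul, hw]
    linear_combination w * this - w * hη
  obtain ⟨a, ha⟩ := exists_padicToW_eq p (w := g 1) (by rw [← hg, map_one])
  obtain ⟨b, hb⟩ := exists_padicToW_eq p (hfix_mul (w := g ε) (by rw [← hg, hε, map_neg]))
  obtain ⟨t, ht⟩ : ∃ t : ℤ_[p], 2 * t = 1 := by
    have : IsUnit ((2 : ℕ) : ℤ_[p]) := by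
      rw [PadicInt.isUnit_iff, PadicInt.norm_natCast_eq_one_iff]
      exact (Nat.coprime_primes Fact.out Nat.prime_two).2 hp
    simpa using this.exists_right_inv
  have ht' : 2 * padicToW p t = 1 := by
    rw [← map_ofNat (padicToW p) 2, ← map_mul, ht, map_one]
  refine ⟨t * (a + b), t * (a - b), ?_⟩
  rw [← sub_eq_zero]
  set F := g - groupRingAction p (t * (a + b)) (t * (a - b)) with hF
  have hF1 : F 1 = 0 := by
    simp only [hF, AddMonoidHom.sub_apply, groupRingAction_apply, ← ha, map_mul, map_add, map_sub,
      map_one]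
    linear_combination - padicToW p a * ht'
  have hFε : F ε = 0 := by
    simp only [hF, AddMonoidHom.sub_apply, groupRingAction_apply, hε, map_mul, map_add, map_sub]
    linear_combination - padicToW p b * ε * ht' - ε * hb - g ε * hη
  ext1 w
  obtain ⟨x, hx⟩ := exists_padicToW_eq p (w := w + frobW p w)
    (by rw [map_add, frobW_frobW, add_comm])
  obtain ⟨y, hy⟩ := exists_padicToW_eq p (hfix_mul (w := w - frobW p w)
    (by rw [map_sub, frobW_frobW, neg_sub]))
  have hw : w + w = padicToW p x * 1 + padicToW p y * ε := by
    linear_combination -hx - ε * hy - (w - frobW p w) * hη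
  have h2 : F w + F w = 0 := by
    rw [← map_add, hw, map_add, addMonoidHom_padicToW_mul_eq_zero p F hF1,
      addMonoidHom_padicToW_mul_eq_zero p F hFε, add_zero]
  rw [← two_mul] at h2
  exact (mul_eq_zero.1 h2).resolve_left (two_ne_zero_W p)

end Equivariant

section Decomposition

variable (p : ℕ) [Fact p.Prime]

theorem isUnit_natCast_sq_sub_one :
    IsUnit ((p ^ 2 - 1 : ℕ) : WittVector p (GaloisField p 2)) := by
  refine WittVector.isUnit_of_coeff_zero_ne_zero _ ?_
  change WittVector.constantCoeff _ ≠ 0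
  rw [map_natCast, Nat.cast_sub (Nat.one_le_pow _ _ (Fact.out : p.Prime).pos)]
  simp

theorem card_units_galoisField_two : Nat.card (GaloisField p 2)ˣ = p ^ 2 - 1 := by
  rw [Nat.card_units, GaloisField.card p 2 two_ne_zero]

theorem units_hom_eq_one
    (f : (GaloisField p 2)ˣ →* Multiplicative (WittVector p (GaloisField p 2))) : f = 1 := by
  ext1 a
  have h : f a ^ (p ^ 2 - 1) = 1 := by
    rw [← map_pow, ← card_units_galoisField_two, pow_card_eq_one', map_one]
  have h' := congrArg Multiplicative.toAdd h
  rw [toAdd_pow, toAdd_one, nsmul_eq_mul, mul_eq_zero] at h'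
  exact Multiplicative.toAdd.injective
    (h'.resolve_left (isUnit_natCast_sq_sub_one p).ne_zero)

theorem hom_units_eq_one
    (f : Multiplicative (WittVector p (GaloisField p 2)) →* (GaloisField p 2)ˣ) : f = 1 := by
  refine MonoidHom.ext fun w => ?_
  obtain ⟨b, hb⟩ := (isUnit_natCast_sq_sub_one p).exists_right_inv
  have h : w = Multiplicative.ofAdd (b * w.toAdd) ^ (p ^ 2 - 1) := by
    apply Multiplicative.toAdd.injective
    rw [toAdd_pow, toAdd_ofAdd, nsmul_eq_mul, ← mul_assoc, hb, one_mul]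
  rw [h, map_pow, ← card_units_galoisField_two, pow_card_eq_one', MonoidHom.one_apply]

end Decomposition

/-- Let `p ≥ 5` be a prime, `W = W(𝔽_{p²})`, and `σ` the Galois action
on `Wˣ`.  The abelian group (under pointwise multiplication) of group endomorphisms of
`Wˣ` commuting with `σ` is isomorphic to `ℤ_p × ℤ_p × ℤ/(p² - 1)`.  We express this by
an injective map `Φ` taking addition to pointwise multiplication whose range is exactly
the set of `σ`-equivariant endomorphisms. -/
theorem stmt13 (p : ℕ) [Fact p.Prime] (hp : 5 ≤ p) :
    ∃ Φ : ℤ_[p] × ℤ_[p] × ZMod (p ^ 2 - 1) →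
        ((WittVector p (GaloisField p 2))ˣ →* (WittVector p (GaloisField p 2))ˣ),
      Function.Injective Φ ∧
      (∀ a b, Φ (a + b) = Φ a * Φ b) ∧
      Set.range Φ =
        {f : (WittVector p (GaloisField p 2))ˣ →* (WittVector p (GaloisField p 2))ˣ |
          ∀ u, f (Units.map (frobW p).toMonoidHom u) =
            Units.map (frobW p).toMonoidHom (f u)} := by
  have hp2 : 2 < p := by omega
  have : NeZero (p ^ 2 - 1) :=
    ⟨fun h => (isUnit_natCast_sq_sub_one p).ne_zero (by rw [h, Nat.cast_zero])⟩
  have hcard := card_units_galoisField_two p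
  obtain ⟨Θ, hΘ⟩ := WittVector.exists_units_mulEquiv p hp2 (GaloisField p 2)
  replace hΘ := hΘ (frobenius (GaloisField p 2) p)
  change ∀ z, Units.map (frobW p).toMonoidHom (Θ z) =
    Θ (_, (frobW p).toAddMonoidHom.toMultiplicative z.2) at hΘ
  let Ψ (z : ℤ_[p] × ℤ_[p] × ZMod (p ^ 2 - 1)) :=
    (powMonoidHom (α := (GaloisField p 2)ˣ) z.2.2.val).prodMap
      (groupRingAction p z.1 z.2.1).toMultiplicative
  have hΨ (z a w) : Ψ z (a, w) =
    (a ^ z.2.2.val, Multiplicative.ofAdd (groupRingAction p z.1 z.2.1 w.toAdd)) := rfl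
  refine ⟨fun z => Θ.toMonoidHom.comp ((Ψ z).comp Θ.symm.toMonoidHom), ?_, ?_, ?_⟩
  · intro z z' h
    have h' (x) : Ψ z x = Ψ z' x := Θ.injective (by simpa using DFunLike.congr_fun h (Θ x))
    have h1 (a) := congrArg Prod.fst (h' (a, 1))
    have h2 (w) := congrArg Prod.snd (h' (1, Multiplicative.ofAdd w))
    obtain ⟨hc, hd⟩ := groupRingAction_injective p (AddMonoidHom.ext h2)
    exact Prod.ext hc (Prod.ext hd (IsCyclic.pow_zmodVal_injective hcard h1))
  · intro z z'
    ext1 u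
    obtain ⟨⟨a, w⟩, rfl⟩ := Θ.surjective u
    have h : Ψ (z + z') (a, w) = Ψ z (a, w) * Ψ z' (a, w) := by
      rw [hΨ, hΨ, hΨ, Prod.mk_mul_mk, ← ofAdd_add, ← pow_add]
      refine Prod.ext ?_ (congrArg Multiplicative.ofAdd ?_)
      · change a ^ (z.2.2 + z'.2.2).val = _
        exact pow_zmodVal_add hcard a _ _
      · simp only [Prod.fst_add, Prod.snd_add, groupRingAction_apply, map_add]
        ring
    simpa using congrArg Θ h
  · ext f
    constructor
    · rintro ⟨z, rfl⟩ u
      obtain ⟨⟨a, w⟩, rfl⟩ := Θ.surjective u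
      simp only [MonoidHom.comp_apply, MulEquiv.toMonoidHom_eq_coe, MonoidHom.coe_coe,
        MulEquiv.symm_apply_apply, hΘ, hΨ]
      rw [map_pow]
      exact congrArg Θ (Prod.ext rfl (congrArg Multiplicative.ofAdd
        (groupRingAction_frobW p z.1 z.2.1 w.toAdd)))
    · intro hf
      obtain ⟨g, h, hgh⟩ := MonoidHom.exists_eq_prodMap (units_hom_eq_one p) (hom_units_eq_one p)
        (Θ.symm.toMonoidHom.comp (f.comp Θ.toMonoidHom))
      have hfΘ (a w) : f (Θ (a, w)) = Θ (g a, h w) := by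
        rw [← MulEquiv.symm_apply_eq]
        exact DFunLike.congr_fun hgh (a, w)
      obtain ⟨m, hm⟩ := IsCyclic.exists_pow_zmodVal_eq hcard g
      obtain ⟨c, d, hcd⟩ := exists_groupRingAction_eq p hp2.ne'
        (AddMonoidHom.toMultiplicative.symm h)
        (fun w => by
          have := hf (Θ (1, Multiplicative.ofAdd w))
          rw [hfΘ, hΘ, hΘ, hfΘ] at this
          exact congrArg Prod.snd (Θ.injective this))
      refine ⟨(c, d, m), ?_⟩
      ext1 u
      obtain ⟨⟨a, w⟩, rfl⟩ := Θ.surjective u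
      rw [hfΘ, hm]
      have : Ψ (c, d, m) (a, w) = (a ^ m.val, h w) := by
        rw [hΨ, ← hcd]
        rfl
      simpa using congrArg Θ this
end
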